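/- arXiv:1904.12851 — 4 statements merged into one kernel-verified Lean document; each statement's English description precedes it below -/
import Mathlib

section
/- The element c_K := K_1 K_2 ⋯ K_d is central in the two-parameter Hecke algebra ℋ^B_{Q,q}(d) of type B, i.e. it commutes with every element of ℋ^B_{Q,q}(d) (equivalently, with each generator T_0, T_1, …, T_{d−1}). -/
/-- The element `c_K = K_1 K_2 ⋯ K_d` is central in the
two-parameter Hecke algebra `ℋ^B_{Q,q}(d)` of type B, i.e. it commutes with
every element (equivalently, with each generator `T_0, …, T_{d-1}`).  We
formalize this via the universal property of the presented algebra: for any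
associative unital `k`-algebra `A` and any family of elements `T 0, …, T (d-1)`
of `A` satisfying the defining relations of `ℋ^B_{Q,q}(d)`, the product of the
Jucys–Murphy elements commutes with each generator. -/
theorem cK_central
    {k : Type*} [Field k] {A : Type*} [Ring A] [Algebra k A]
    (Q q : k) (hQ : Q ≠ 0) (hq : q ≠ 0) (d : ℕ) (hd : 1 ≤ d)
    (T : ℕ → A)
    (relT0 : (T 0 + algebraMap k A Q) * (T 0 - algebraMap k A Q⁻¹) = 0)
    (relTi : ∀ i, 0 < i → i < d →
      (T i + algebraMap k A q) * (T i - algebraMap k A q⁻¹) = 0)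
    (relBraid : ∀ i, 0 < i → i + 1 < d →
      T i * T (i + 1) * T i = T (i + 1) * T i * T (i + 1))
    (relT0T1 : 1 < d → T 0 * T 1 * T 0 * T 1 = T 1 * T 0 * T 1 * T 0)
    (relComm : ∀ i j, i + 1 < j → j < d → T i * T j = T j * T i)
    (K : ℕ → A)
    (hK1 : K 1 = T 0)
    (hKsucc : ∀ i, 1 ≤ i → K (i + 1) = T i * K i * T i)
    (cK : A)
    (hcK : cK = ((List.range d).map (fun i => K (i + 1))).prod) :
    ∀ i, i < d → cK * T i = T i * cK := by
  -- T_j commutes with K_i for j > i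
  have h1 : ∀ i, 1 ≤ i → ∀ j, i < j → j < d → Commute (T j) (K i) := by
    intro i hi
    induction i, hi using Nat.le_induction with
    | base =>
      intro j hj hjd
      rw [hK1]
      exact (relComm 0 j (by omega) hjd).symm
    | succ i hi ih =>
      intro j hj hjd
      rw [hKsucc i hi]
      have a : Commute (T j) (T i) := (relComm i j (by omega) hjd).symm
      exact (a.mul_right (ih j (by omega) hjd)).mul_right a
  -- T_j commutes with K_(j+2)
  have h2 : ∀ j, j + 1 < d → Commute (T j) (K (j + 2)) := by
    intro j hj
    rcases Nat.eq_zero_or_pos j with rfl | hp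
    · have e := relT0T1 (by omega)
      rw [hKsucc 1 le_rfl, hK1]
      show T 0 * (T 1 * T 0 * T 1) = T 1 * T 0 * T 1 * T 0
      rw [← e]; simp only [mul_assoc]
    · rw [hKsucc (j + 1) (by omega), hKsucc j hp]
      have b := relBraid j hp hj
      have c : T (j + 1) * K j = K j * T (j + 1) := h1 j hp (j + 1) (by omega) hj
      show T j * (T (j + 1) * (T j * K j * T j) * T (j + 1))
        = T (j + 1) * (T j * K j * T j) * T (j + 1) * T j
      calc T j * (T (j + 1) * (T j * K j * T j) * T (j + 1))
          = (T j * T (j + 1) * T j) * K j * T j * T (j + 1) := by simp only [mul_assoc]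
        _ = T (j + 1) * T j * (T (j + 1) * K j) * T j * T (j + 1) := by
            rw [b]; simp only [mul_assoc]
        _ = T (j + 1) * T j * K j * (T (j + 1) * T j * T (j + 1)) := by
            rw [c]; simp only [mul_assoc]
        _ = T (j + 1) * (T j * K j * T j) * T (j + 1) * T j := by
            rw [← b]; simp only [mul_assoc]
  have h3 : ∀ j m, j + 2 ≤ m → m ≤ d → Commute (T j) (K m) := by
    intro j m hm
    induction m, hm using Nat.le_induction with
    | base => intro h; exact h2 j (by omega)
    | succ m hm ih =>
      intro h
      rw [hKsucc m (by omega)]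
      have a : Commute (T j) (T m) := relComm j m (by omega) (by omega)
      exact (a.mul_right (ih (by omega))).mul_right a
  have h4 : ∀ i, 1 ≤ i → ∀ m, i < m → m ≤ d → Commute (K i) (K m) := by
    intro i hi
    induction i, hi using Nat.le_induction with
    | base =>
      intro m hm hmd
      rw [hK1]
      exact h3 0 m (by omega) hmd
    | succ i hi ih =>
      intro m hm hmd
      rw [hKsucc i hi]
      have a := h3 i m (by omega) hmd
      exact (a.mul_left (ih m (by omega) hmd)).mul_left a
  have h5 : ∀ i, 1 ≤ i → i < d → Commute (K i * K (i + 1)) (T i) := by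
    intro i hi hid
    have c : K i * K (i + 1) = K (i + 1) * K i := h4 i hi (i + 1) (by omega) (by omega)
    show K i * K (i + 1) * T i = T i * (K i * K (i + 1))
    nth_rewrite 1 [c]
    rw [hKsucc i hi] at c ⊢
    simp only [mul_assoc] at c ⊢
  have h6 : ∀ n j, n < j → j < d →
      Commute ((List.range n).map (fun i => K (i + 1))).prod (T j) := by
    intro n
    induction n with
    | zero => intro j _ _; simp
    | succ n ih =>
      intro j hj hjd
      rw [List.prod_range_succ]
      exact (ih j (by omega) hjd).mul_left (h1 (n + 1) (by omega) j hj hjd).symm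
  have h7 : ∀ n, n ≤ d → ∀ i, i < n →
      Commute ((List.range n).map (fun i => K (i + 1))).prod (T i) := by
    intro n
    induction n with
    | zero => intro _ i hi; omega
    | succ n ih =>
      intro hn i hi
      rcases Nat.lt_succ_iff_lt_or_eq.mp hi with h | rfl
      · rw [List.prod_range_succ]
        exact (ih (by omega) i h).mul_left (h3 i (n + 1) (by omega) hn).symm
      · cases i with
        | zero => simp [hK1]
        | succ m =>
          rw [List.prod_range_succ, List.prod_range_succ, mul_assoc]
          exact (h6 m (m + 1) (by omega) (by omega)).mul_left (h5 (m + 1) (by omega) (by omega))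
  intro i hi
  rw [hcK]
  exact h7 d le_rfl i hi
end

section
/- Let 1 ≤ i ≤ d−1 and suppose v ∈ V_n^{⊗d} is a nonzero simultaneous eigenvector for the operators K_i and K_{i+1}, with K_i v = a v and K_{i+1} v = b v. Then either there exists a nonzero simultaneous eigenvector w ∈ V_n^{⊗d} with K_i w = b w and K_{i+1} w = a w, or b = q^2 a, or b = q^{−2} a. -/
noncomputable section
namespace QSP

variable {k : Type*} [Field k]

/-- Doubled value of a basis index: `val n j = 2*j - (n-1)`, so that the basis
indices of `V_n` are the integers/half-integers `val/2` in `𝕀_n`. -/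
def val (n : ℕ) (j : Fin n) : ℤ := 2 * (j : ℤ) - ((n : ℤ) - 1)

/-- Matrix of the operator `K_Q` on `V_n` in the standard basis. -/
def KQmat (Q : k) (n : ℕ) : Matrix (Fin n) (Fin n) k := fun c b =>
  if val n b = 0 then (if c = b then Q⁻¹ else 0)
  else (if c = Fin.rev b then 1 else 0) + (if val n b < 0 ∧ c = b then Q⁻¹ - Q else 0)

/-- Matrix of the operator `R_q` on `V_n ⊗ V_n` in the standard basis. -/
def Rmat (q : k) (n : ℕ) : Matrix (Fin n × Fin n) (Fin n × Fin n) k := fun c b =>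
  if b.1 = b.2 then (if c = b then q⁻¹ else 0)
  else if b.1 < b.2 then (if c = (b.2, b.1) then 1 else 0)
  else (if c = (b.2, b.1) then 1 else 0) + (if c = b then q⁻¹ - q else 0)

/-- The operators `T_i`, `0 ≤ i ≤ d-1`, on `V_n^{⊗ d}`; `T_0` acts as `K_Q` on the
first tensor factor, and `T_i` (for `i > 0`) acts as `R_q` on the `(i, i+1)`
tensor factors (1-based). -/
def TB (Q q : k) (n d : ℕ) (i : ℕ) : Module.End k ((Fin d → Fin n) → k) :=
  if _h0 : i = 0 then
    if hd : 0 < d then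
      Matrix.toLin' (fun c b =>
        if ∀ j, j ≠ (⟨0, hd⟩ : Fin d) → c j = b j then
          KQmat Q n (c ⟨0, hd⟩) (b ⟨0, hd⟩) else 0)
    else 0
  else if hi : i < d then
    Matrix.toLin' (fun c b =>
      if ∀ j, j ≠ (⟨i - 1, Nat.lt_of_le_of_lt (Nat.pred_le i) hi⟩ : Fin d) →
          j ≠ (⟨i, hi⟩ : Fin d) → c j = b j then
        Rmat q n (c ⟨i - 1, Nat.lt_of_le_of_lt (Nat.pred_le i) hi⟩, c ⟨i, hi⟩)
          (b ⟨i - 1, Nat.lt_of_le_of_lt (Nat.pred_le i) hi⟩, b ⟨i, hi⟩) else 0)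
  else 0

/-- The Jucys–Murphy elements `K_i = T_{i-1} ⋯ T_1 T_0 T_1 ⋯ T_{i-1}` acting on
`V_n^{⊗ d}`, for `1 ≤ i ≤ d` (junk value `1` for `i = 0`). -/
def JM (Q q : k) (n d : ℕ) : ℕ → Module.End k ((Fin d → Fin n) → k)
  | 0 => 1
  | 1 => TB Q q n d 0
  | i + 2 => TB Q q n d (i + 1) * JM Q q n d (i + 1) * TB Q q n d (i + 1)

/-- The element `c_K = K_1 K_2 ⋯ K_d` acting on `V_n^{⊗ d}`. -/
def cK (Q q : k) (n d : ℕ) : Module.End k ((Fin d → Fin n) → k) :=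
  ((List.range d).map (fun i => JM Q q n d (i + 1))).prod


theorem entry_aux (q : k) (n d : ℕ) (x y : Fin d) (hxy : x ≠ y) (c b : Fin d → Fin n) :
    (if ∀ j, j ≠ x → j ≠ y → c j = b j then Rmat q n (c x, c y) (b x, b y) else 0)
    = (if b = c then (if c x = c y then q⁻¹ else if c y < c x then q⁻¹ - q else 0) else 0)
      + (if b = c ∘ Equiv.swap x y then (if c x = c y then 0 else 1) else 0) := by
  have e1 : b = c ↔ (∀ j, j ≠ x → j ≠ y → c j = b j) ∧ b x = c x ∧ b y = c y := by
    constructor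
    · rintro rfl; simp
    · rintro ⟨h, h1, h2⟩
      funext j
      by_cases hx : j = x
      · rw [hx, h1]
      by_cases hy : j = y
      · rw [hy, h2]
      exact (h j hx hy).symm
  have e2 : b = c ∘ Equiv.swap x y ↔
      (∀ j, j ≠ x → j ≠ y → c j = b j) ∧ b x = c y ∧ b y = c x := by
    constructor
    · rintro rfl
      refine ⟨fun j h1 h2 => ?_, by simp, by simp⟩
      simp [Equiv.swap_apply_of_ne_of_ne h1 h2]
    · rintro ⟨h, h1, h2⟩
      funext j
      by_cases hx : j = x
      · rw [hx, h1]; simp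
      by_cases hy : j = y
      · rw [hy, h2]; simp
      simp [Equiv.swap_apply_of_ne_of_ne hx hy, h j hx hy]
  simp only [e1, e2]
  by_cases h : ∀ j, j ≠ x → j ≠ y → c j = b j
  · simp only [h, Rmat, Prod.mk.injEq]
    generalize b x = b1
    generalize b y = b2
    generalize c x = c1
    generalize c y = c2
    grind
  · simp only [h]; simp

theorem TB_apply (Q q : k) (n d i : ℕ) (hi0 : i ≠ 0) (hi : i < d) :
    ∃ x y : Fin d, x ≠ y ∧ ∀ (v : (Fin d → Fin n) → k) (c : Fin d → Fin n),
      TB Q q n d i v c =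
        (if c x = c y then q⁻¹ else if c y < c x then q⁻¹ - q else 0) * v c
        + (if c x = c y then 0 else 1) * v (c ∘ Equiv.swap x y) := by
  have hxy : (⟨i - 1, Nat.lt_of_le_of_lt (Nat.pred_le i) hi⟩ : Fin d) ≠ ⟨i, hi⟩ := by
    simp only [ne_eq, Fin.mk.injEq]; omega
  refine ⟨_, _, hxy, fun v c => ?_⟩
  simp only [TB, hi0, hi, dif_neg, dif_pos, not_false_eq_true]
  erw [Matrix.toLin'_apply]
  simp only [Matrix.mulVec, dotProduct]
  simp_rw [entry_aux q n d _ _ hxy]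
  simp [add_mul, Finset.sum_add_distrib]

theorem TB_sq (Q q : k) (hq : q ≠ 0) (n d i : ℕ) (hi0 : i ≠ 0) (hi : i < d)
    (v : (Fin d → Fin n) → k) :
    TB Q q n d i (TB Q q n d i v) = v + (q⁻¹ - q) • TB Q q n d i v := by
  obtain ⟨x, y, hxy, h⟩ := TB_apply Q q n d i hi0 hi
  funext c
  have hs : (c ∘ Equiv.swap x y) ∘ Equiv.swap x y = c := by
    funext j; simp
  simp only [Pi.add_apply, Pi.smul_apply, smul_eq_mul, h, hs]
  simp only [Function.comp_apply, Equiv.swap_apply_left, Equiv.swap_apply_right]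
  rcases lt_trichotomy (c x) (c y) with h1 | h1 | h1
  · simp [h1.ne, h1.ne', h1, h1.not_gt]; ring
  · simp [h1]; field_simp; ring
  · simp [h1.ne, h1.ne', h1, h1.not_gt]; ring

/-- If `v ∈ V_n^{⊗d}` is a nonzero simultaneous eigenvector for
`K_i` and `K_{i+1}` with eigenvalues `a` and `b` respectively (`1 ≤ i ≤ d-1`),
then either there is a nonzero simultaneous eigenvector `w` with the eigenvalues
swapped, or `b = q^2 a`, or `b = q^{-2} a`. -/
theorem eigenvalue_swap_or_shift
    (Q q : k) (hQ : Q ≠ 0) (hq : q ≠ 0) (n d : ℕ) (hn : 1 ≤ n) (hd : 1 ≤ d)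
    (i : ℕ) (hi1 : 1 ≤ i) (hi2 : i ≤ d - 1)
    (v : (Fin d → Fin n) → k) (hv : v ≠ 0) (a b : k)
    (hva : JM Q q n d i v = a • v) (hvb : JM Q q n d (i + 1) v = b • v) :
    (∃ w : (Fin d → Fin n) → k, w ≠ 0 ∧
      JM Q q n d i w = b • w ∧ JM Q q n d (i + 1) w = a • w) ∨
    b = q ^ 2 * a ∨ b = (q ^ 2)⁻¹ * a := by
  obtain ⟨m, rfl⟩ : ∃ m, i = m + 1 := ⟨i - 1, by omega⟩
  have hT := TB_sq Q q hq n d (m + 1) (by omega) (by omega)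
  have hL : ∀ u, JM Q q n d (m + 1 + 1) u =
    TB Q q n d (m + 1) (JM Q q n d (m + 1) (TB Q q n d (m + 1) u)) := fun u => rfl
  generalize JM Q q n d (m + 1 + 1) = L at *
  generalize JM Q q n d (m + 1) = K at *
  generalize TB Q q n d (m + 1) = T at *
  by_cases hab : a = b
  · subst hab; exact Or.inl ⟨v, hv, hva, hvb⟩
  have hab' : a - b ≠ 0 := sub_ne_zero.mpr hab
  set c := q⁻¹ - q with hc
  have hKT : K (T v) = b • (T v - c • v) := by
    have h1 := hT (K (T v))
    rw [← hL v, hvb, map_smul] at h1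
    rw [smul_sub, h1, smul_comm c b v]; abel
  have hLT : L (T v) = a • T v + (c * b) • v := by
    rw [hL, hT, map_add, map_add, hva, map_smul, map_smul, map_smul, ← hL, hvb, smul_smul]
  by_cases hw : (a - b) • T v + (b * c) • v = 0
  · right
    obtain ⟨l, hl⟩ : ∃ l : k, T v = l • v := by
      refine ⟨-((a - b)⁻¹ * (b * c)), ?_⟩
      have h2 := congrArg (fun u => (a - b)⁻¹ • u) (eq_neg_of_add_eq_zero_left hw)
      simp only [smul_smul, inv_mul_cancel₀ hab', one_smul, smul_neg] at h2
      rw [h2, neg_smul]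
    have hinj := smul_left_injective k hv
    have h3 : l * l = 1 + c * l := by
      apply hinj
      have := hT v
      simp only [hl, map_smul, smul_smul] at this
      simp only [add_smul, one_smul, this]
    have h4 : b = l * a * l := by
      apply hinj
      have := hL v
      simp only [hl, map_smul, smul_smul, hva, hvb] at this
      simp only [this]
    have h5 : (l - q⁻¹) * (l + q) = 0 := by
      have : q⁻¹ * q = 1 := inv_mul_cancel₀ hq
      rw [hc] at h3
      linear_combination h3 - this
    rcases mul_eq_zero.mp h5 with h6 | h6
    · right
      rw [h4, sub_eq_zero.mp h6]; field_simp
    · left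
      rw [h4, eq_neg_of_add_eq_zero_left h6]; ring
  · left
    refine ⟨_, hw, ?_, ?_⟩
    · rw [map_add, map_smul, map_smul, hKT, hva]; module
    · rw [map_add, map_smul, map_smul, hLT, hvb]; module

end QSP
end
end

section
/- For every 1 ≤ i ≤ d, every eigenvalue λ ∈ k of the operator K_i on V_n^{⊗d} is of the form λ = −Q q^{2j} or λ = Q^{−1} q^{2j} for some integer j with |j| < i. -/
noncomputable section
namespace QSP

variable {k : Type*} [Field k]

/-- Hecke operator at positions `p`, `r`. -/
def Rop (q : k) {n d : ℕ} (p r : Fin d) (f : (Fin d → Fin n) → k) (c : Fin d → Fin n) : k :=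
  if c p = c r then q⁻¹ * f c
  else f (c ∘ Equiv.swap p r) + if c r < c p then (q⁻¹ - q) * f c else 0

/-- Boundary operator at position `p`. -/
def Kop (Q : k) {n d : ℕ} (p : Fin d) (f : (Fin d → Fin n) → k) (c : Fin d → Fin n) : k :=
  if val n (c p) = 0 then Q⁻¹ * f c
  else f (Function.update c p (Fin.rev (c p))) + if val n (c p) < 0 then (Q⁻¹ - Q) * f c else 0

lemma val_rev (n : ℕ) (x : Fin n) : val n (Fin.rev x) = - val n x := by
  have := x.2
  simp only [val, Fin.val_rev]
  omega

lemma val_inj {n : ℕ} {x y : Fin n} : x = y ↔ val n x = val n y := by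
  rw [Fin.ext_iff]; simp only [val]; omega

lemma val_lt {n : ℕ} {x y : Fin n} : x < y ↔ val n x < val n y := by
  rw [Fin.lt_def]; simp only [val]; omega

lemma TB_zero_apply (Q q : k) (n d : ℕ) (hd : 0 < d) (f : (Fin d → Fin n) → k) :
    TB Q q n d 0 f = Kop Q ⟨0, hd⟩ f := by
  funext c
  have e : TB Q q n d 0 f c = ∑ b, (if ∀ j, j ≠ (⟨0, hd⟩ : Fin d) → c j = b j then
      KQmat Q n (c ⟨0, hd⟩) (b ⟨0, hd⟩) else 0) * f b := by
    unfold TB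
    rw [dif_pos rfl, dif_pos hd]
    rfl
  rw [e, Kop]
  clear e
  set p : Fin d := ⟨0, hd⟩
  have key : ∀ b : Fin d → Fin n, (∀ j, j ≠ p → c j = b j) → c p = b p → b = c := by
    intro b h1 h2
    funext j
    by_cases hj : j = p
    · rw [hj, h2]
    · exact (h1 j hj).symm
  have key2 : ∀ b : Fin d → Fin n, (∀ j, j ≠ p → c j = b j) → c p = Fin.rev (b p) →
      b = Function.update c p (Fin.rev (c p)) := by
    intro b h1 h2
    funext j
    by_cases hj : j = p
    · subst hj; simp [h2]
    · simp [hj, h1 j hj]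
  split_ifs with h h'
  · rw [Finset.sum_eq_single c]
    · simp [KQmat, h]
    · intro b _ hb
      split_ifs with h1
      · have h2 : c p ≠ b p := fun h2 => hb (key b h1 h2)
        have h3 : c p ≠ Fin.rev (b p) := by
          intro h3
          apply h2
          rw [val_inj]
          rw [h3, val_rev] at h
          rw [h3, val_rev]; omega
        simp [KQmat, h2, h3]
      · simp
    · simp
  all_goals
    have hr : Fin.rev (c p) ≠ c p := by
      intro h3
      rw [val_inj, val_rev] at h3
      omega
    have hne : c ≠ Function.update c p (Fin.rev (c p)) := by
      intro h3
      have := congrFun h3 p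
      simp only [Function.update_self] at this
      exact hr this.symm
    rw [Finset.sum_eq_add c (Function.update c p (Fin.rev (c p))) hne]
    · have a1 : ∀ j, j ≠ p → c j = Function.update c p (Fin.rev (c p)) j := by
        intro j hj; simp [hj]
      rw [if_pos a1]
      simp [KQmat, h, h', val_rev, hr.symm, add_comm]
    · intro b _ hb
      split_ifs with h1
      · have h2 : c p ≠ b p := fun h2 => hb.1 (key b h1 h2)
        have h3 : c p ≠ Fin.rev (b p) := fun h2 => hb.2 (key2 b h1 h2)
        simp [KQmat, h2, h3]
      · simp
    · simp
    · simp

lemma TB_succ_apply (Q q : k) (n d i : ℕ) (hi : i + 1 < d) (f : (Fin d → Fin n) → k) :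
    TB Q q n d (i + 1) f = Rop q ⟨i, by omega⟩ ⟨i + 1, hi⟩ f := by
  funext c
  have e : TB Q q n d (i + 1) f c =
      ∑ b, (if ∀ j, j ≠ (⟨i, by omega⟩ : Fin d) → j ≠ (⟨i + 1, hi⟩ : Fin d) → c j = b j then
      Rmat q n (c ⟨i, by omega⟩, c ⟨i + 1, hi⟩) (b ⟨i, by omega⟩, b ⟨i + 1, hi⟩) else 0) * f b := by
    unfold TB
    rw [dif_neg (Nat.succ_ne_zero i), dif_pos hi]
    rfl
  rw [e, Rop]
  clear e
  have hpr : (⟨i, by omega⟩ : Fin d) ≠ ⟨i + 1, hi⟩ := by simp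
  set p : Fin d := ⟨i, by omega⟩
  set r : Fin d := ⟨i + 1, hi⟩
  have key : ∀ b : Fin d → Fin n, (∀ j, j ≠ p → j ≠ r → c j = b j) → c p = b p → c r = b r →
      b = c := by
    intro b h1 h2 h3
    funext j
    by_cases hj : j = p
    · rw [hj, h2]
    by_cases hj' : j = r
    · rw [hj', h3]
    · exact (h1 j hj hj').symm
  have key2 : ∀ b : Fin d → Fin n, (∀ j, j ≠ p → j ≠ r → c j = b j) → c p = b r → c r = b p →
      b = c ∘ Equiv.swap p r := by
    intro b h1 h2 h3
    funext j
    by_cases hj : j = p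
    · simp [hj, h3]
    by_cases hj' : j = r
    · simp [hj', h2]
    · simp [Equiv.swap_apply_of_ne_of_ne hj hj', h1 j hj hj']
  split_ifs with h h'
  · rw [Finset.sum_eq_single c]
    · simp [Rmat, h]
    · intro b _ hb
      split_ifs with h1
      · have h2 : ¬ (c p = b p ∧ c r = b r) := fun h2 => hb (key b h1 h2.1 h2.2)
        have h3 : ¬ (c p = b r ∧ c r = b p) := by
          rintro ⟨h3, h4⟩
          apply h2
          constructor
          · rw [h, h4]
          · rw [← h, h3]
        simp [Rmat, Prod.ext_iff, h2, h3]
      · simp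
    · simp
  all_goals
    have hne : c ≠ c ∘ Equiv.swap p r := by
      intro h3
      have := congrFun h3 p
      simp only [Function.comp, Equiv.swap_apply_left] at this
      exact h this
    rw [Finset.sum_eq_add c (c ∘ Equiv.swap p r) hne]
    · have a1 : ∀ j, j ≠ p → j ≠ r → c j = (c ∘ Equiv.swap p r) j := by
        intro j hj hj'; simp [Equiv.swap_apply_of_ne_of_ne hj hj']
      rw [if_pos a1]
      have h'' : ¬ (c r = c p) := fun e => h e.symm
      rcases lt_or_gt_of_ne h with h4 | h4
      · simp [Rmat, Prod.ext_iff, h, h'', h4, h4.not_gt]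
        try (exfalso; exact h4.not_gt h')
      · simp [Rmat, Prod.ext_iff, h, h'', h4, h4.not_gt, add_comm]
        try (exfalso; exact h' h4)
    · intro b _ hb
      split_ifs with h1
      · have h2 : ¬ (c p = b p ∧ c r = b r) := fun h2 => hb.1 (key b h1 h2.1 h2.2)
        have h3 : ¬ (c p = b r ∧ c r = b p) := fun h2 => hb.2 (key2 b h1 h2.1 h2.2)
        simp [Rmat, Prod.ext_iff, h2, h3]
      · simp
    · simp
    · simp

lemma Kop_quad (Q : k) (hQ : Q ≠ 0) {n d : ℕ} (p : Fin d) (f : (Fin d → Fin n) → k) :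
    Kop Q p (Kop Q p f) = (Q⁻¹ - Q) • Kop Q p f + f := by
  funext c
  simp only [Kop, Pi.add_apply, Pi.smul_apply, smul_eq_mul, Function.update_self, val_rev,
    Fin.rev_rev, Function.update_idem, Function.update_eq_self]
  rcases lt_trichotomy (val n (c p)) 0 with h | h | h
  · simp [h, h.ne, h.not_gt]; ring
  · simp [h]; field_simp; ring
  · simp [h, h.ne', h.not_gt]; ring

lemma comp_swap_swap {α : Type*} {d : ℕ} (c : Fin d → α) (p r : Fin d) :
    (c ∘ Equiv.swap p r) ∘ Equiv.swap p r = c := by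
  funext j; simp

lemma Rop_quad (q : k) (hq : q ≠ 0) {n d : ℕ} (p r : Fin d) (f : (Fin d → Fin n) → k) :
    Rop q p r (Rop q p r f) = (q⁻¹ - q) • Rop q p r f + f := by
  funext c
  simp only [Rop, Pi.add_apply, Pi.smul_apply, smul_eq_mul, comp_swap_swap]
  simp only [Function.comp, Equiv.swap_apply_left, Equiv.swap_apply_right]
  rcases lt_trichotomy (c p) (c r) with h | h | h
  · simp [h, h.ne, h.ne', h.not_gt]; ring
  · simp [h]; field_simp; ring
  · simp [h, h.ne, h.ne', h.not_gt]; ring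

/-- Three-position update. -/
def U3 {n d : ℕ} (p r s : Fin d) (c : Fin d → Fin n) (x y z : Fin n) : Fin d → Fin n :=
  fun j => if j = p then x else if j = r then y else if j = s then z else c j

lemma U3_self {n d : ℕ} (p r s : Fin d) (c : Fin d → Fin n) :
    U3 p r s c (c p) (c r) (c s) = c := by
  funext j; simp only [U3]; split_ifs <;> simp_all

lemma Rop_U3_left (q : k) {n d : ℕ} {p r s : Fin d} (hpr : p ≠ r)
    (f : (Fin d → Fin n) → k) (c : Fin d → Fin n) (x y z : Fin n) :
    Rop q p r f (U3 p r s c x y z) = if x = y then q⁻¹ * f (U3 p r s c x y z) else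
      f (U3 p r s c y x z) + if y < x then (q⁻¹ - q) * f (U3 p r s c x y z) else 0 := by
  have e : U3 p r s c x y z ∘ Equiv.swap p r = U3 p r s c y x z := by
    funext j
    simp only [Function.comp, Equiv.swap_apply_def, U3]
    split_ifs <;> simp_all
  rw [Rop, e]
  simp [U3, hpr.symm]

lemma Rop_U3_right (q : k) {n d : ℕ} {p r s : Fin d} (hpr : p ≠ r) (hps : p ≠ s) (hrs : r ≠ s)
    (f : (Fin d → Fin n) → k) (c : Fin d → Fin n) (x y z : Fin n) :
    Rop q r s f (U3 p r s c x y z) = if y = z then q⁻¹ * f (U3 p r s c x y z) else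
      f (U3 p r s c x z y) + if z < y then (q⁻¹ - q) * f (U3 p r s c x y z) else 0 := by
  have e : U3 p r s c x y z ∘ Equiv.swap r s = U3 p r s c x z y := by
    funext j
    simp only [Function.comp, Equiv.swap_apply_def, U3]
    split_ifs <;> simp_all
  rw [Rop, e]
  simp [U3, hpr.symm, hps.symm, hrs.symm]

set_option maxHeartbeats 1600000 in
lemma Rop_braid (q : k) (hq : q ≠ 0) {n d : ℕ} {p r s : Fin d} (hpr : p ≠ r) (hps : p ≠ s)
    (hrs : r ≠ s) (f : (Fin d → Fin n) → k) :
    Rop q p r (Rop q r s (Rop q p r f)) = Rop q r s (Rop q p r (Rop q r s f)) := by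
  funext c
  rw [← U3_self p r s c]
  generalize c p = x
  generalize c r = y
  generalize c s = z
  simp only [Rop_U3_left q hpr, Rop_U3_right q hpr hps hrs]
  rcases lt_trichotomy x y with h | h | h <;>
  rcases lt_trichotomy x z with h' | h' | h' <;>
  rcases lt_trichotomy y z with h'' | h'' | h'' <;>
  first
  | (exfalso; order)
  | (subst_vars; simp [*, ne_of_lt, ne_of_gt, not_lt_of_gt] <;> field_simp <;> ring)

lemma Kop_U3 (Q : k) {n d : ℕ} {p r s : Fin d}
    (f : (Fin d → Fin n) → k) (c : Fin d → Fin n) (x y z : Fin n) :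
    Kop Q p f (U3 p r s c x y z) = if val n x = 0 then Q⁻¹ * f (U3 p r s c x y z) else
      f (U3 p r s c (Fin.rev x) y z) +
        if val n x < 0 then (Q⁻¹ - Q) * f (U3 p r s c x y z) else 0 := by
  have e : Function.update (U3 p r s c x y z) p (Fin.rev x) = U3 p r s c (Fin.rev x) y z := by
    funext j
    simp only [Function.update_apply, U3]
    split_ifs <;> simp_all
  have e1 : U3 p r s c x y z p = x := by simp [U3]
  rw [Kop, e1, e]

set_option maxHeartbeats 4000000 in
lemma refl_eq (Q q : k) (hQ : Q ≠ 0) (hq : q ≠ 0) {n d : ℕ} {p r : Fin d} (hpr : p ≠ r)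
    (f : (Fin d → Fin n) → k) :
    Kop Q p (Rop q p r (Kop Q p (Rop q p r f))) =
      Rop q p r (Kop Q p (Rop q p r (Kop Q p f))) := by
  funext c
  rw [← U3_self p r r c]
  generalize c p = x
  generalize c r = y
  generalize c r = z
  simp only [Rop_U3_left q hpr, Kop_U3 Q, Fin.rev_rev, val_rev, val_lt, val_inj]
  rcases lt_trichotomy (val n x) 0 with hx | hx | hx <;>
  rcases lt_trichotomy (val n y) 0 with hy | hy | hy <;>
  rcases lt_trichotomy (val n x) (val n y) with h | h | h <;>
  rcases lt_trichotomy (val n x) (- val n y) with h' | h' | h' <;>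
  first
  | (exfalso; omega)
  | (simp (disch := omega) only [if_pos, if_neg] <;>
     first
     | (obtain rfl := val_inj.2 h; field_simp <;> ring)
     | (rw [← val_rev] at h'; obtain rfl := val_inj.2 h'
        simp only [Fin.rev_rev]; field_simp <;> ring)
     | (field_simp <;> ring))

lemma Rop_comm (q : k) {n d : ℕ} {p r s t : Fin d} (hps : p ≠ s) (hpt : p ≠ t)
    (hrs : r ≠ s) (hrt : r ≠ t) (f : (Fin d → Fin n) → k) :
    Rop q p r (Rop q s t f) = Rop q s t (Rop q p r f) := by
  funext c
  have e : (c ∘ Equiv.swap p r) ∘ Equiv.swap s t = (c ∘ Equiv.swap s t) ∘ Equiv.swap p r := by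
    funext j
    simp only [Function.comp, Equiv.swap_apply_def]
    split_ifs <;> simp_all
  have e1 : (c ∘ Equiv.swap p r) s = c s := by
    simp [Equiv.swap_apply_of_ne_of_ne hps.symm hrs.symm]
  have e2 : (c ∘ Equiv.swap p r) t = c t := by
    simp [Equiv.swap_apply_of_ne_of_ne hpt.symm hrt.symm]
  have e3 : (c ∘ Equiv.swap s t) p = c p := by
    simp [Equiv.swap_apply_of_ne_of_ne hps hpt]
  have e4 : (c ∘ Equiv.swap s t) r = c r := by
    simp [Equiv.swap_apply_of_ne_of_ne hrs hrt]
  simp only [Rop, e1, e2, e3, e4, e]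
  split_ifs <;> ring

lemma Kop_Rop_comm (Q q : k) {n d : ℕ} {p s t : Fin d} (hps : p ≠ s) (hpt : p ≠ t)
    (f : (Fin d → Fin n) → k) :
    Kop Q p (Rop q s t f) = Rop q s t (Kop Q p f) := by
  funext c
  have e : Function.update c p (Fin.rev (c p)) ∘ Equiv.swap s t =
      Function.update (c ∘ Equiv.swap s t) p (Fin.rev (c p)) := by
    funext j
    simp only [Function.comp, Equiv.swap_apply_def, Function.update_apply]
    split_ifs <;> simp_all
  have e3 : (c ∘ Equiv.swap s t) p = c p := by
    simp [Equiv.swap_apply_of_ne_of_ne hps hpt]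
  simp only [Kop, Rop, e3, e, Function.update_of_ne hps.symm, Function.update_of_ne hpt.symm]
  split_ifs <;> ring

lemma TB_quad (Q q : k) (hq : q ≠ 0) (n d i : ℕ) (hi : i + 1 < d) :
    TB Q q n d (i + 1) * TB Q q n d (i + 1) = (q⁻¹ - q) • TB Q q n d (i + 1) + 1 := by
  refine LinearMap.ext fun f => ?_
  simp only [Module.End.mul_apply, LinearMap.add_apply, LinearMap.smul_apply, Module.End.one_apply,
    TB_succ_apply Q q n d i hi, Rop_quad q hq]

lemma TB_zero_quad (Q q : k) (hQ : Q ≠ 0) (n d : ℕ) (hd : 0 < d) :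
    TB Q q n d 0 * TB Q q n d 0 = (Q⁻¹ - Q) • TB Q q n d 0 + 1 := by
  refine LinearMap.ext fun f => ?_
  simp only [Module.End.mul_apply, LinearMap.add_apply, LinearMap.smul_apply, Module.End.one_apply,
    TB_zero_apply Q q n d hd, Kop_quad Q hQ]

lemma TB_braid (Q q : k) (hq : q ≠ 0) (n d i : ℕ) (hi : i + 2 < d) :
    TB Q q n d (i + 1) * TB Q q n d (i + 2) * TB Q q n d (i + 1) =
    TB Q q n d (i + 2) * TB Q q n d (i + 1) * TB Q q n d (i + 2) := by
  refine LinearMap.ext fun f => ?_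
  simp only [Module.End.mul_apply, TB_succ_apply Q q n d i (by omega),
    TB_succ_apply Q q n d (i + 1) hi]
  exact Rop_braid q hq (by simp) (by simp; omega) (by simp) f

lemma TB_refl (Q q : k) (hQ : Q ≠ 0) (hq : q ≠ 0) (n d : ℕ) (hd : 1 < d) :
    TB Q q n d 0 * TB Q q n d 1 * TB Q q n d 0 * TB Q q n d 1 =
    TB Q q n d 1 * TB Q q n d 0 * TB Q q n d 1 * TB Q q n d 0 := by
  refine LinearMap.ext fun f => ?_
  simp only [Module.End.mul_apply, TB_zero_apply Q q n d (by omega),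
    TB_succ_apply Q q n d 0 hd]
  exact refl_eq Q q hQ hq (by simp) f

lemma TB_comm (Q q : k) (n d i j : ℕ) (hij : i + 2 ≤ j) (hj : j < d) :
    TB Q q n d i * TB Q q n d j = TB Q q n d j * TB Q q n d i := by
  refine LinearMap.ext fun f => ?_
  obtain ⟨j, rfl⟩ : ∃ m, j = m + 1 := ⟨j - 1, by omega⟩
  rcases i with _ | i
  · simp only [Module.End.mul_apply, TB_zero_apply Q q n d (by omega),
      TB_succ_apply Q q n d j hj]
    exact Kop_Rop_comm Q q (by simp; omega) (by simp) f
  · simp only [Module.End.mul_apply, TB_succ_apply Q q n d i (by omega),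
      TB_succ_apply Q q n d j hj]
    exact Rop_comm q (by simp; omega) (by simp; omega) (by simp; omega) (by simp; omega) f

lemma JM_succ (Q q : k) (n d i : ℕ) : JM Q q n d (i + 2) =
    TB Q q n d (i + 1) * JM Q q n d (i + 1) * TB Q q n d (i + 1) := rfl

lemma JM_TB_comm (Q q : k) (n d i j : ℕ) (hij : i + 2 ≤ j) (hj : j < d) :
    JM Q q n d (i + 1) * TB Q q n d j = TB Q q n d j * JM Q q n d (i + 1) := by
  induction i with
  | zero => exact TB_comm Q q n d 0 j hij hj
  | succ i ih =>
    have h1 : Commute (JM Q q n d (i + 1)) (TB Q q n d j) := ih (by omega)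
    have h2 : Commute (TB Q q n d (i + 1)) (TB Q q n d j) := TB_comm Q q n d (i + 1) j hij hj
    rw [JM_succ]
    exact (h2.mul_left h1).mul_left h2

lemma braid_aux {A : Type*} [Monoid A] (a b K : A) (hbK : K * b = b * K)
    (hab : a * b * a = b * a * b) (haK : K * (a * K * a) = a * K * a * K) :
    (a * K * a) * (b * (a * K * a) * b) = (b * (a * K * a) * b) * (a * K * a) := by
  calc (a * K * a) * (b * (a * K * a) * b) = a * K * (a * b * a) * K * a * b := by
        simp only [mul_assoc]
    _ = a * (K * b) * a * (b * K) * a * b := by rw [hab]; simp only [mul_assoc]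
    _ = a * b * K * a * K * (b * a * b) := by
        rw [← hbK]; simp only [mul_assoc]; rw [← mul_assoc K b (a * _), hbK]; simp only [mul_assoc]
    _ = a * b * (K * (a * K * a)) * b * a := by rw [← hab]; simp only [mul_assoc]
    _ = (a * b * a) * K * a * (K * b) * a := by rw [haK]; simp only [mul_assoc]
    _ = b * a * (b * K) * a * b * K * a := by rw [hab, hbK]; simp only [mul_assoc]
    _ = b * a * K * (b * a * b) * K * a := by rw [← hbK]; simp only [mul_assoc]
    _ = (b * (a * K * a) * b) * (a * K * a) := by rw [← hab]; simp only [mul_assoc]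

lemma JM_comm (Q q : k) (hQ : Q ≠ 0) (hq : q ≠ 0) (n d i : ℕ) (hi : i + 1 < d) :
    JM Q q n d (i + 1) * JM Q q n d (i + 2) = JM Q q n d (i + 2) * JM Q q n d (i + 1) := by
  induction i with
  | zero =>
    have := TB_refl Q q hQ hq n d hi
    simp only [JM, mul_assoc] at this ⊢
    exact this
  | succ i ih =>
    rw [JM_succ Q q n d (i + 1), JM_succ Q q n d i]
    apply braid_aux
    · exact JM_TB_comm Q q n d i (i + 2) le_rfl hi
    · exact TB_braid Q q hq n d i hi
    · exact ih (by omega)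

lemma quad_root (Q c : k) (hQ : Q ≠ 0) (h : c * c = (Q⁻¹ - Q) * c + 1) : c = -Q ∨ c = Q⁻¹ := by
  have : (c + Q) * (c - Q⁻¹) = 0 := by
    have : (c + Q) * (c - Q⁻¹) = c * c - ((Q⁻¹ - Q) * c + 1) := by field_simp; ring
    rw [this, h, sub_self]
  rcases mul_eq_zero.1 this with h | h
  · left; exact eq_neg_of_add_eq_zero_left h
  · right; exact sub_eq_zero.1 h

lemma eig_closed [IsAlgClosed k] (Q q : k) (hQ : Q ≠ 0) (hq : q ≠ 0) (n d : ℕ)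
    (i : ℕ) (hi : i + 1 ≤ d) (μ : k)
    (hμ : Module.End.HasEigenvalue (JM Q q n d (i + 1)) μ) :
    ∃ j : ℤ, |j| < (i : ℤ) + 1 ∧ (μ = -(Q * q ^ (2 * j)) ∨ μ = Q⁻¹ * q ^ (2 * j)) := by
  induction i generalizing μ with
  | zero =>
    obtain ⟨v, hv⟩ := hμ.exists_hasEigenvector
    have hv1 : TB Q q n d 0 v = μ • v := hv.apply_eq_smul
    have h := LinearMap.congr_fun (TB_zero_quad Q q hQ n d hi) v
    simp only [Module.End.mul_apply, LinearMap.add_apply, LinearMap.smul_apply,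
      Module.End.one_apply, hv1, map_smul] at h
    have h2 : (μ * μ - ((Q⁻¹ - Q) * μ + 1)) • v = 0 := by
      rw [sub_smul, add_smul, mul_smul, mul_smul, h, one_smul, sub_self]
    have h3 := (smul_eq_zero.1 h2).resolve_right hv.2
    refine ⟨0, by simp, ?_⟩
    simpa using quad_root Q μ hQ (sub_eq_zero.1 h3)
  | succ i ih =>
    have ih := ih (by omega)
    have hcomm := JM_comm Q q hQ hq n d i (by omega)
    have hT := TB_quad Q q hq n d i (by omega)
    have hJ := JM_succ Q q n d i
    set K := JM Q q n d (i + 1)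
    set T := TB Q q n d (i + 1)
    set L := JM Q q n d (i + 1 + 1)
    have hmap : ∀ x ∈ Module.End.eigenspace L μ, K x ∈ Module.End.eigenspace L μ := by
      intro x hx
      rw [Module.End.mem_eigenspace_iff] at hx ⊢
      have := LinearMap.congr_fun hcomm x
      simp only [Module.End.mul_apply] at this
      rw [hx, map_smul] at this
      exact this.symm
    have : Nontrivial (Module.End.eigenspace L μ) := Submodule.nontrivial_iff_ne_bot.2 hμ
    obtain ⟨l, hl⟩ := Module.End.exists_eigenvalue (K.restrict hmap)
    obtain ⟨⟨v, hvL⟩, hv⟩ := hl.exists_hasEigenvector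
    have hv0 : v ≠ 0 := by
      intro h
      exact hv.2 (Subtype.ext h)
    have hvK : K v = l • v := congrArg Subtype.val hv.apply_eq_smul
    rw [Module.End.mem_eigenspace_iff] at hvL
    have hlK : Module.End.HasEigenvalue K l :=
      Module.End.hasEigenvalue_of_hasEigenvector (x := v)
        ⟨Module.End.mem_eigenspace_iff.2 hvK, hv0⟩
    have hT2 : ∀ x, T (T x) = (q⁻¹ - q) • T x + x := by
      intro x
      have := LinearMap.congr_fun hT x
      simpa only [Module.End.mul_apply, LinearMap.add_apply, LinearMap.smul_apply,
        Module.End.one_apply] using this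
    have hTKT : T (K (T v)) = μ • v := by rw [← hvL, hJ]; rfl
    have finish_same : ∀ m, Module.End.HasEigenvalue K m →
        ∃ j : ℤ, |j| < ((i + 1 : ℕ) : ℤ) + 1 ∧
          (m = -(Q * q ^ (2 * j)) ∨ m = Q⁻¹ * q ^ (2 * j)) := by
      intro m hm
      obtain ⟨j, hj, h⟩ := ih m hm
      exact ⟨j, by push_cast; omega, h⟩
    by_cases hc : ∃ c : k, T v = c • v
    · obtain ⟨c, hc⟩ := hc
      have h := hT2 v
      simp only [hc, map_smul] at h
      have h2 : (c * c - ((q⁻¹ - q) * c + 1)) • v = 0 := by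
        rw [sub_smul, add_smul, mul_smul, mul_smul, h, one_smul, sub_self]
      have h3 := (smul_eq_zero.1 h2).resolve_right hv0
      have h4 := quad_root q c hq (sub_eq_zero.1 h3)
      rw [hc, map_smul, hvK, map_smul, map_smul, hc, smul_smul, smul_smul] at hTKT
      have h5 : μ = c * l * c := (smul_left_injective k hv0 hTKT).symm
      clear h
      obtain ⟨j, hj, h⟩ := ih l hlK
      rw [abs_lt] at hj
      rcases h4 with rfl | rfl
      · refine ⟨j + 1, by rw [abs_lt]; push_cast; omega, ?_⟩
        have : q ^ (2 * (j + 1)) = q ^ (2 * j) * (q * q) := by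
          rw [mul_add, zpow_add₀ hq]; norm_num [zpow_ofNat, pow_two]
        rcases h with h | h
        · left; rw [h5, h, this]; ring
        · right; rw [h5, h, this]; ring
      · refine ⟨j - 1, by rw [abs_lt]; push_cast; omega, ?_⟩
        have : q ^ (2 * (j - 1)) = q ^ (2 * j) * (q⁻¹ * q⁻¹) := by
          rw [mul_sub, zpow_sub₀ hq]; norm_num [zpow_ofNat, pow_two, div_eq_mul_inv]
        rcases h with h | h
        · left; rw [h5, h, this]; ring
        · right; rw [h5, h, this]; ring
    · by_cases hlm : l = μ
      · exact finish_same μ (hlm ▸ hlK)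
      · apply finish_same
        have hKT : K (T v) = μ • (T v - (q⁻¹ - q) • v) := by
          have h1 := hT2 (K (T v))
          rw [hTKT, map_smul] at h1
          rw [smul_sub, h1, smul_comm μ]
          abel
        have hsub : l - μ ≠ 0 := sub_ne_zero.2 hlm
        refine Module.End.hasEigenvalue_of_hasEigenvector
          (x := T v + (μ * (q⁻¹ - q) / (l - μ)) • v)
          ⟨Module.End.mem_eigenspace_iff.2 ?_, ?_⟩
        · rw [map_add, map_smul, hKT, hvK]
          have e : μ * (q⁻¹ - q) / (l - μ) * l =
              μ * (q⁻¹ - q) + μ * (μ * (q⁻¹ - q) / (l - μ)) := by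
            field_simp; ring
          rw [smul_smul, e, smul_add, smul_sub, add_smul, smul_smul, smul_smul]
          abel
        · intro h
          apply hc
          exact ⟨-(μ * (q⁻¹ - q) / (l - μ)), by rw [neg_smul]; exact eq_neg_of_add_eq_zero_left h⟩

section
variable {L : Type*} [Field L]

lemma TB_map (φ : k →+* L) (Q q : k) (n d i : ℕ) (hi : i < d) (f : (Fin d → Fin n) → k) :
    TB (φ Q) (φ q) n d i (φ ∘ f) = φ ∘ TB Q q n d i f := by
  rcases i with _ | i
  · rw [TB_zero_apply _ _ _ _ hi, TB_zero_apply _ _ _ _ hi]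
    funext c
    simp only [Kop, Function.comp]
    split_ifs <;> simp
  · rw [TB_succ_apply _ _ _ _ _ hi, TB_succ_apply _ _ _ _ _ hi]
    funext c
    simp only [Rop, Function.comp_apply]
    split_ifs <;> simp

lemma JM_map (φ : k →+* L) (Q q : k) (n d i : ℕ) (hi : i < d) (f : (Fin d → Fin n) → k) :
    JM (φ Q) (φ q) n d (i + 1) (φ ∘ f) = φ ∘ JM Q q n d (i + 1) f := by
  induction i generalizing f with
  | zero => exact TB_map φ Q q n d 0 hi f
  | succ i ih =>
    simp only [JM_succ, Module.End.mul_apply]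
    rw [TB_map φ Q q n d (i + 1) hi, ih (by omega), TB_map φ Q q n d (i + 1) hi]

end

/-- Every eigenvalue of the Jucys–Murphy operator `K_i` on
`V_n^{⊗d}` (for `1 ≤ i ≤ d`) is of the form `-Q q^{2j}` or `Q⁻¹ q^{2j}` for some
integer `j` with `|j| < i`. -/
theorem eigenvalues_JM
    (Q q : k) (hQ : Q ≠ 0) (hq : q ≠ 0) (n d : ℕ) (hn : 1 ≤ n) (hd : 1 ≤ d)
    (i : ℕ) (hi1 : 1 ≤ i) (hi2 : i ≤ d) (μ : k)
    (hμ : Module.End.HasEigenvalue (JM Q q n d i) μ) :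
    ∃ j : ℤ, |j| < (i : ℤ) ∧ (μ = -(Q * q ^ (2 * j)) ∨ μ = Q⁻¹ * q ^ (2 * j)) := by
  obtain ⟨i, rfl⟩ : ∃ m, i = m + 1 := ⟨i - 1, by omega⟩
  set φ := algebraMap k (AlgebraicClosure k)
  obtain ⟨v, hv⟩ := hμ.exists_hasEigenvector
  have hinj : Function.Injective φ := φ.injective
  have h : Module.End.HasEigenvalue (JM (φ Q) (φ q) n d (i + 1)) (φ μ) := by
    refine Module.End.hasEigenvalue_of_hasEigenvector (x := φ ∘ v)
      ⟨Module.End.mem_eigenspace_iff.2 ?_, ?_⟩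
    · rw [JM_map φ Q q n d i (by omega), hv.apply_eq_smul]
      funext c
      simp
    · intro h0
      apply hv.2
      funext c
      have := congrFun h0 c
      simpa using this
  obtain ⟨j, hj, hh⟩ := eig_closed (φ Q) (φ q) (by simpa using hQ) (by simpa using hq) n d i hi2 _ h
  refine ⟨j, by push_cast; exact hj, ?_⟩
  rcases hh with hh | hh
  · left; apply hinj; rw [hh]; simp
  · right; apply hinj; rw [hh]; simp

end QSP
end
end

section
/- Let θ be a composition of d indexed by 𝕀_n, let θ' (indexed by 𝕀_{n+2}) be obtained from θ by adding 0's in pairs at a place j > 0, and, when n is even, let θ'' (indexed by 𝕀_{n+1}) be obtained from θ by adding a 0 at place 0. Then the permutation modules V_θ ⊆ V_n^{⊗d}, V_{θ'} ⊆ V_{n+2}^{⊗d} and V_{θ''} ⊆ V_{n+1}^{⊗d} are pairwise isomorphic as ℋ^B_{Q,q}(d)-modules: there exist k-linear isomorphisms between them intertwining the respective operators T_0, …, T_{d−1}. -/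
noncomputable section
namespace QSP

variable {k : Type*} [Field k]

/-- Generator `s_i` of the Weyl group `W^B(d)` acting on index tuples: `s_0`
negates (reverses) the first entry, and `s_i` (`i > 0`) swaps entries `i` and
`i+1` (1-based), i.e. positions `i-1` and `i` (0-based). -/
def gAct {n d : ℕ} (i : Fin d) (x : Fin d → Fin n) : Fin d → Fin n :=
  if (i : ℕ) = 0 then Function.update x i (Fin.rev (x i))
  else x ∘ Equiv.swap (⟨(i : ℕ) - 1, Nat.lt_of_le_of_lt (Nat.pred_le _) i.isLt⟩ : Fin d) i

/-- Action of a word in the generators `s_0, …, s_{d-1}` on index tuples. -/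
def wAct {n d : ℕ} : List (Fin d) → (Fin d → Fin n) → (Fin d → Fin n)
  | [], x => x
  | i :: u, x => gAct i (wAct u x)

/-- The orbit of a tuple `a ∈ 𝕀_n^d` under the Weyl group `W^B(d)`. -/
def orbitB {n d : ℕ} (a : Fin d → Fin n) : Set (Fin d → Fin n) :=
  {b | ∃ u : List (Fin d), wAct u a = b}

/-- The permutation module `V(a, n) ⊆ V_n^{⊗d}`: the span of the standard basis
vectors `v_{wa}` for `w ∈ W^B(d)`. -/
def permMod (k : Type*) [Field k] {n d : ℕ} (a : Fin d → Fin n) :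
    Submodule k ((Fin d → Fin n) → k) :=
  Submodule.span k ((fun b => Pi.single b (1 : k)) '' orbitB a)

/-- Two submodules `U ⊆ V_m^{⊗d}` and `W ⊆ V_{m'}^{⊗d}` are isomorphic as
`ℋ^B_{Q,q}(d)`-modules: both are invariant under the operators `T_0, …, T_{d-1}`
and there is a `k`-linear isomorphism between them intertwining these
operators. -/
def heckeIso (Q q : k) (d m m' : ℕ)
    (U : Submodule k ((Fin d → Fin m) → k)) (W : Submodule k ((Fin d → Fin m') → k)) : Prop :=
  ∃ e : U ≃ₗ[k] W,
    ∀ i < d,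
      (∀ x ∈ U, TB Q q m d i x ∈ U) ∧ (∀ y ∈ W, TB Q q m' d i y ∈ W) ∧
      ∀ (x : (Fin d → Fin m) → k) (hx : x ∈ U) (hTx : TB Q q m d i x ∈ U),
        (e ⟨TB Q q m d i x, hTx⟩ : (Fin d → Fin m') → k) = TB Q q m' d i (e ⟨x, hx⟩)

/-- Extension of a composition `θ` indexed by `𝕀_n` (encoded as `Fin n`) to all
integer index positions, by zero. -/
def thetaPad {n : ℕ} (θ : Fin n → ℕ) (m : ℤ) : ℕ :=
  if h : 0 ≤ m ∧ m < (n : ℤ) then θ ⟨m.toNat, by omega⟩ else 0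

/-- The weakly increasing list in which each `l ∈ 𝕀_n` occurs `θ l` times. -/
def compList {n : ℕ} (θ : Fin n → ℕ) : List (Fin n) :=
  (List.finRange n).flatMap fun l => List.replicate (θ l) l

/-- The weakly increasing tuple `a(θ) ∈ 𝕀_n^d` in which each `l ∈ 𝕀_n` occurs
`θ l` times (for `θ` a composition of `d`). -/
def compToTuple {n d : ℕ} (hn : 0 < n) (θ : Fin n → ℕ) : Fin d → Fin n :=
  fun j => (compList θ).getD (j : ℕ) ⟨0, hn⟩

/-- The composition `θ'` indexed by `𝕀_{n+2}` obtained from `θ` by adding `0`'s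
in pairs at the places `±j`, where `j > 0` is the value of the place `p`. -/
def addZerosPair {n : ℕ} (θ : Fin n → ℕ) (p : Fin (n + 2)) : Fin (n + 2) → ℕ := fun l =>
  if val (n + 2) l = val (n + 2) p ∨ val (n + 2) l = -val (n + 2) p then 0
  else if val (n + 2) l < -val (n + 2) p then thetaPad θ (l : ℤ)
  else if val (n + 2) p < val (n + 2) l then thetaPad θ ((l : ℤ) - 2)
  else thetaPad θ ((l : ℤ) - 1)

/-- The composition `θ''` indexed by `𝕀_{n+1}` obtained from `θ` (for `n` even)
by adding a `0` at the place `0`. -/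
def addZeroMid {n : ℕ} (θ : Fin n → ℕ) : Fin (n + 1) → ℕ := fun l =>
  if val (n + 1) l = 0 then 0
  else if val (n + 1) l < 0 then thetaPad θ (l : ℤ)
  else thetaPad θ ((l : ℤ) - 1)

theorem toLin_single {ι : Type*} [Fintype ι] [DecidableEq ι] (M : Matrix ι ι k) (b c : ι) :
    Matrix.toLin' M (Pi.single b 1) c = M c b := by
  simp

def cA {n d : ℕ} (k : Type*) [Field k] (i : Fin d) (b : Fin d → Fin n) : k :=
  if (i : ℕ) = 0 then (if val n (b i) = 0 then 0 else 1)
  else if b ⟨(i : ℕ) - 1, Nat.lt_of_le_of_lt (Nat.pred_le _) i.isLt⟩ = b i then 0 else 1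

def cB {n d : ℕ} (Q q : k) (i : Fin d) (b : Fin d → Fin n) : k :=
  if (i : ℕ) = 0 then (if val n (b i) = 0 then Q⁻¹ else if val n (b i) < 0 then Q⁻¹ - Q else 0)
  else if b ⟨(i : ℕ) - 1, Nat.lt_of_le_of_lt (Nat.pred_le _) i.isLt⟩ = b i then q⁻¹
  else if b ⟨(i : ℕ) - 1, Nat.lt_of_le_of_lt (Nat.pred_le _) i.isLt⟩ < b i then 0
  else q⁻¹ - q

theorem TB_single (Q q : k) {n d : ℕ} (i : Fin d) (b : Fin d → Fin n) :
    TB Q q n d i (Pi.single b 1) =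
      cA k i b • (Pi.single (gAct i b) 1 : (Fin d → Fin n) → k) + cB Q q i b • Pi.single b 1 := by
  obtain ⟨i, hi⟩ := i
  funext c
  by_cases h0 : i = 0
  · subst h0
    have e1 : c = b ↔ (∀ j, j ≠ (⟨0, hi⟩ : Fin d) → c j = b j) ∧ c ⟨0, hi⟩ = b ⟨0, hi⟩ := by
      constructor
      · rintro rfl; simp
      · rintro ⟨h, h'⟩; funext j
        by_cases hj : j = ⟨0, hi⟩
        · rw [hj, h']
        · exact h j hj
    have e2 : c = gAct ⟨0, hi⟩ b ↔
        (∀ j, j ≠ (⟨0, hi⟩ : Fin d) → c j = b j) ∧ c ⟨0, hi⟩ = Fin.rev (b ⟨0, hi⟩) := by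
      simp only [gAct, if_true]
      rw [Function.eq_update_iff]
      tauto
    unfold TB
    rw [dif_pos rfl, dif_pos hi]
    refine (toLin_single _ _ _).trans ?_
    simp only [Pi.add_apply, Pi.smul_apply, Pi.single_apply, smul_eq_mul, e1, e2, cA, cB,
      KQmat, if_true]
    clear e1 e2
    by_cases hP : ∀ j, j ≠ (⟨0, hi⟩ : Fin d) → c j = b j
    · simp only [eq_true hP, if_true, true_and]
      clear hP
      generalize c ⟨0, hi⟩ = x
      generalize b ⟨0, hi⟩ = y
      by_cases h1 : val n y = 0 <;> by_cases h2 : val n y < 0 <;> simp [h1, h2]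
    · simp only [eq_false hP, if_false, false_and]
      simp
  · have hi' : i - 1 < d := by omega
    have hne : (⟨i - 1, hi'⟩ : Fin d) ≠ ⟨i, hi⟩ := by
      simp only [ne_eq, Fin.mk.injEq]; omega
    have e1 : c = b ↔ (∀ j, j ≠ (⟨i - 1, hi'⟩ : Fin d) → j ≠ (⟨i, hi⟩ : Fin d) → c j = b j) ∧
        c ⟨i - 1, hi'⟩ = b ⟨i - 1, hi'⟩ ∧ c ⟨i, hi⟩ = b ⟨i, hi⟩ := by
      constructor
      · rintro rfl; simp
      · rintro ⟨h, h', h''⟩; funext j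
        by_cases hj : j = ⟨i, hi⟩
        · rw [hj, h'']
        by_cases hj' : j = ⟨i - 1, hi'⟩
        · rw [hj', h']
        · exact h j hj' hj
    have e2 : c = gAct ⟨i, hi⟩ b ↔
        (∀ j, j ≠ (⟨i - 1, hi'⟩ : Fin d) → j ≠ (⟨i, hi⟩ : Fin d) → c j = b j) ∧
        c ⟨i - 1, hi'⟩ = b ⟨i, hi⟩ ∧ c ⟨i, hi⟩ = b ⟨i - 1, hi'⟩ := by
      simp only [gAct, if_neg h0]
      constructor
      · rintro rfl
        refine ⟨fun j h1 h2 => ?_, ?_, ?_⟩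
        · simp [Equiv.swap_apply_of_ne_of_ne h1 h2]
        · simp
        · simp
      · rintro ⟨h, h', h''⟩; funext j
        by_cases hj : j = ⟨i, hi⟩
        · rw [hj, h'']; simp
        by_cases hj' : j = ⟨i - 1, hi'⟩
        · rw [hj', h']; simp
        · rw [h j hj' hj]; simp [Equiv.swap_apply_of_ne_of_ne hj' hj]
    unfold TB
    rw [dif_neg h0, dif_pos hi]
    refine (toLin_single _ _ _).trans ?_
    simp only [Pi.add_apply, Pi.smul_apply, Pi.single_apply, smul_eq_mul, e1, e2, cA, cB,
      Rmat, if_neg h0, Prod.mk.injEq]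
    by_cases hP : ∀ j, j ≠ (⟨i - 1, hi'⟩ : Fin d) → j ≠ (⟨i, hi⟩ : Fin d) → c j = b j
    · simp only [eq_true hP, if_true, true_and]
      clear e1 e2 hP
      generalize c ⟨i, hi⟩ = x
      generalize b ⟨i, hi⟩ = y
      generalize c ⟨i - 1, hi'⟩ = x'
      generalize b ⟨i - 1, hi'⟩ = y'
      by_cases h1 : y' = y
      · simp [h1]
      · by_cases h2 : y' < y <;> simp [h1, h2]
    · simp only [eq_false hP, if_false, false_and]
      simp

theorem TB_inv (Q q : k) {n d : ℕ} (a : Fin d → Fin n) (i : Fin d)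
    (x : (Fin d → Fin n) → k) (hx : x ∈ permMod k a) : TB Q q n d i x ∈ permMod k a := by
  unfold permMod at hx
  induction hx using Submodule.span_induction with
  | mem x hx =>
    obtain ⟨b, ⟨u, rfl⟩, rfl⟩ := hx
    simp only [TB_single]
    refine Submodule.add_mem _ (Submodule.smul_mem _ _ (Submodule.subset_span ?_))
      (Submodule.smul_mem _ _ (Submodule.subset_span ?_))
    · exact ⟨_, ⟨i :: u, rfl⟩, rfl⟩
    · exact ⟨_, ⟨u, rfl⟩, rfl⟩
  | zero => simp
  | add x y _ _ h1 h2 => rw [map_add]; exact Submodule.add_mem _ h1 h2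
  | smul r x _ h => rw [map_smul]; exact Submodule.smul_mem _ _ h

/-- order embeddings compatible with the symmetric structure -/
structure Good {n m : ℕ} (ι : Fin n → Fin m) : Prop where
  mono : StrictMono ι
  rev : ∀ x, ι (Fin.rev x) = Fin.rev (ι x)
  zero : ∀ x, val m (ι x) = 0 ↔ val n x = 0
  neg : ∀ x, val m (ι x) < 0 ↔ val n x < 0

theorem gAct_comp {n m d : ℕ} {ι : Fin n → Fin m} (h : Good ι) (i : Fin d) (b : Fin d → Fin n) :
    gAct i (ι ∘ b) = ι ∘ gAct i b := by
  unfold gAct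
  split_ifs
  · rw [Function.comp_update, h.rev]; rfl
  · rfl

theorem wAct_comp {n m d : ℕ} {ι : Fin n → Fin m} (h : Good ι) (u : List (Fin d))
    (b : Fin d → Fin n) : wAct u (ι ∘ b) = ι ∘ wAct u b := by
  induction u with
  | nil => rfl
  | cons i u ih => simp only [wAct, ih, gAct_comp h]

def EE (k : Type*) [Field k] {n m : ℕ} (d : ℕ) (ι : Fin n → Fin m) :
    ((Fin d → Fin n) → k) →ₗ[k] ((Fin d → Fin m) → k) :=
  Function.ExtendByZero.linearMap k (fun b : Fin d → Fin n => ι ∘ b)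

theorem EE_single {n m d : ℕ} {ι : Fin n → Fin m} (h : Good ι) (b : Fin d → Fin n) :
    EE k d ι (Pi.single b 1) = Pi.single (ι ∘ b) 1 := by
  have hinj : Function.Injective (fun b : Fin d → Fin n => ι ∘ b) := h.mono.injective.comp_left
  funext c
  simp only [EE, Function.ExtendByZero.linearMap_apply]
  by_cases hc : ∃ b', ι ∘ b' = c
  · obtain ⟨b', rfl⟩ := hc
    rw [hinj.extend_apply, Pi.single_apply, Pi.single_apply]
    simp only [hinj.eq_iff]
  · rw [Function.extend_apply' _ _ _ hc, Pi.single_apply, if_neg]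
    · rfl
    · rintro rfl; exact hc ⟨b, rfl⟩

theorem EE_inj {n m d : ℕ} {ι : Fin n → Fin m} (h : Good ι) :
    Function.Injective (EE k d ι) := by
  have hinj : Function.Injective (fun b : Fin d → Fin n => ι ∘ b) := h.mono.injective.comp_left
  intro x y hxy
  funext b
  have := congrFun hxy (ι ∘ b)
  simp only [EE, Function.ExtendByZero.linearMap_apply] at this
  rwa [hinj.extend_apply, hinj.extend_apply] at this

theorem EE_TB (Q q : k) {n m d : ℕ} {ι : Fin n → Fin m} (h : Good ι) (i : Fin d)
    (x : (Fin d → Fin n) → k) : EE k d ι (TB Q q n d i x) = TB Q q m d i (EE k d ι x) := by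
  suffices H : EE k d ι ∘ₗ TB Q q n d i = TB Q q m d i ∘ₗ EE k d ι from LinearMap.congr_fun H x
  refine (Pi.basisFun k (Fin d → Fin n)).ext fun b => ?_
  have e1 : cA k i (ι ∘ b) = cA k i b := by
    simp only [cA, Function.comp, h.zero, h.mono.injective.eq_iff]
  have e2 : cB Q q i (ι ∘ b) = cB Q q i b := by
    simp only [cB, Function.comp, h.zero, h.neg, h.mono.injective.eq_iff, h.mono.lt_iff_lt]
  simp only [Pi.basisFun_apply, LinearMap.comp_apply, TB_single, EE_single h, map_add, map_smul,
    gAct_comp h, e1, e2]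

theorem EE_map {n m d : ℕ} {ι : Fin n → Fin m} (h : Good ι) (a : Fin d → Fin n) :
    (permMod k a).map (EE k d ι) = permMod k (ι ∘ a) := by
  unfold permMod
  rw [Submodule.map_span]
  congr 1
  ext y
  simp only [Set.mem_image, orbitB, Set.mem_ofPred_eq]
  constructor
  · rintro ⟨_, ⟨_, ⟨u, rfl⟩, rfl⟩, rfl⟩
    exact ⟨_, ⟨u, rfl⟩, by rw [EE_single h, wAct_comp h]⟩
  · rintro ⟨_, ⟨u, rfl⟩, rfl⟩
    exact ⟨_, ⟨_, ⟨u, rfl⟩, rfl⟩, by rw [EE_single h, wAct_comp h]⟩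

theorem hecke_of_good (Q q : k) {n m d : ℕ} {ι : Fin n → Fin m} (h : Good ι) (a : Fin d → Fin n)
    (a' : Fin d → Fin m) (ha : a' = ι ∘ a) :
    heckeIso Q q d n m (permMod k a) (permMod k a') := by
  subst ha
  refine ⟨(Submodule.equivMapOfInjective _ (EE_inj h) (permMod k a)).trans
    (LinearEquiv.ofEq _ _ (EE_map h a)), fun i hi => ⟨?_, ?_, ?_⟩⟩
  · exact TB_inv Q q a ⟨i, hi⟩
  · exact TB_inv Q q (ι ∘ a) ⟨i, hi⟩
  · intro x hx hTx
    simpa using EE_TB Q q h ⟨i, hi⟩ x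

theorem hecke_symm {Q q : k} {d m m' : ℕ} {U : Submodule k ((Fin d → Fin m) → k)}
    {W : Submodule k ((Fin d → Fin m') → k)} (h : heckeIso Q q d m m' U W) :
    heckeIso Q q d m' m W U := by
  obtain ⟨e, he⟩ := h
  refine ⟨e.symm, fun i hi => ⟨(he i hi).2.1, (he i hi).1, fun y hy hTy => ?_⟩⟩
  have h1 := (he i hi).1 _ (e.symm ⟨y, hy⟩).2
  have h2 := (he i hi).2.2 _ (e.symm ⟨y, hy⟩).2 h1
  have h3 : e ⟨_, h1⟩ = ⟨_, hTy⟩ := by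
    apply Subtype.ext
    rw [h2]; simp
  rw [← h3]; simp

theorem hecke_trans {Q q : k} {d m m' m'' : ℕ} {U : Submodule k ((Fin d → Fin m) → k)}
    {W : Submodule k ((Fin d → Fin m') → k)} {X : Submodule k ((Fin d → Fin m'') → k)}
    (h : heckeIso Q q d m m' U W) (h' : heckeIso Q q d m' m'' W X) :
    heckeIso Q q d m m'' U X := by
  obtain ⟨e, he⟩ := h
  obtain ⟨f, hf⟩ := h'
  refine ⟨e.trans f, fun i hi => ⟨(he i hi).1, (hf i hi).2.1, fun x hx hTx => ?_⟩⟩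
  have h2 := (he i hi).2.2 x hx hTx
  have h1 := (hf i hi).1 _ (e ⟨x, hx⟩).2
  have h3 := (hf i hi).2.2 _ (e ⟨x, hx⟩).2 h1
  have h4 : e ⟨_, hTx⟩ = ⟨_, h1⟩ := Subtype.ext h2
  simp only [LinearEquiv.trans_apply, h4]
  exact h3

theorem count_compList {n : ℕ} (θ : Fin n → ℕ) (x : Fin n) : (compList θ).count x = θ x := by
  unfold compList
  rw [List.count_flatMap]
  have : (List.count x ∘ fun l => List.replicate (θ l) l) = fun l => if l = x then θ l else 0 := by
    funext l; simp [List.count_replicate]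
  rw [this, ← List.ofFn_eq_map, List.sum_ofFn]
  simp

theorem sorted_compList {n : ℕ} (θ : Fin n → ℕ) : (compList θ).Pairwise (· ≤ ·) := by
  unfold compList
  rw [List.pairwise_flatMap]
  constructor
  · intro l _
    simp [List.pairwise_replicate]
  · refine (List.pairwise_lt_finRange n).imp ?_
    intro a b hab x hx y hy
    rw [List.eq_of_mem_replicate hx, List.eq_of_mem_replicate hy]
    exact hab.le

theorem length_compList {n : ℕ} (θ : Fin n → ℕ) : (compList θ).length = ∑ l, θ l := by
  unfold compList
  rw [List.length_flatMap]
  simp only [List.length_replicate]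
  rw [← List.ofFn_eq_map, List.sum_ofFn]

theorem compList_map {n m : ℕ} {ι : Fin n → Fin m} (h : StrictMono ι) (θ : Fin n → ℕ)
    (θ' : Fin m → ℕ) (h1 : ∀ x, θ' (ι x) = θ x) (h2 : ∀ y, (∀ x, ι x ≠ y) → θ' y = 0) :
    compList θ' = (compList θ).map ι := by
  refine List.Perm.eq_of_pairwise (le := (· ≤ ·)) (fun a b _ _ => le_antisymm) (sorted_compList θ') ?_ ?_
  · rw [List.pairwise_map]
    exact (sorted_compList θ).imp fun hab => h.monotone hab
  · rw [List.perm_iff_count]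
    intro y
    rw [count_compList]
    by_cases hy : ∃ x, ι x = y
    · obtain ⟨x, rfl⟩ := hy
      rw [List.count_map_of_injective _ _ h.injective, count_compList, h1]
    · push Not at hy
      rw [h2 y hy, eq_comm, List.count_eq_zero]
      intro hm
      obtain ⟨x, _, hx⟩ := List.mem_map.1 hm
      exact hy x hx

theorem compToTuple_map {n m d : ℕ} (hn : 0 < n) (hm : 0 < m) {ι : Fin n → Fin m}
    (h : StrictMono ι) (θ : Fin n → ℕ) (hθ : ∑ l, θ l = d)
    (θ' : Fin m → ℕ) (h1 : ∀ x, θ' (ι x) = θ x) (h2 : ∀ y, (∀ x, ι x ≠ y) → θ' y = 0) :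
    compToTuple (d := d) hm θ' = ι ∘ compToTuple (d := d) hn θ := by
  funext j
  have hl : (j : ℕ) < (compList θ).length := by rw [length_compList, hθ]; exact j.2
  simp only [compToTuple, compList_map h θ θ' h1 h2, Function.comp]
  rw [List.getD_eq_getElem _ _ hl, List.getD_eq_getElem _ _ (by simpa using hl), List.getElem_map]

def iPair {n : ℕ} (p : Fin (n + 2)) (x : Fin n) : Fin (n + 2) :=
  if (x : ℕ) + (p : ℕ) < n + 1 then ⟨x, by omega⟩
  else if (x : ℕ) + 1 < (p : ℕ) then ⟨x + 1, by omega⟩ else ⟨x + 2, by omega⟩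

def iMid {n : ℕ} (x : Fin n) : Fin (n + 1) :=
  if 2 * (x : ℕ) < n then ⟨x, by omega⟩ else ⟨x + 1, by omega⟩

theorem iPair_val {n : ℕ} (p : Fin (n + 2)) (x : Fin n) : (iPair p x : ℕ) =
    if (x : ℕ) + (p : ℕ) < n + 1 then (x : ℕ)
    else if (x : ℕ) + 1 < (p : ℕ) then x + 1 else x + 2 := by
  unfold iPair; split_ifs <;> rfl

theorem iMid_val {n : ℕ} (x : Fin n) : (iMid x : ℕ) =
    if 2 * (x : ℕ) < n then (x : ℕ) else x + 1 := by
  unfold iMid; split_ifs <;> rfl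

theorem good_pair {n : ℕ} (p : Fin (n + 2)) (hp : 0 < val (n + 2) p) : Good (iPair p) := by
  unfold val at hp
  push_cast at hp
  refine ⟨fun x y hxy => ?_, fun x => ?_, fun x => ?_, fun x => ?_⟩
  · rw [Fin.lt_def] at *
    rw [iPair_val, iPair_val]; split_ifs <;> omega
  · apply Fin.ext
    have := x.2
    rw [Fin.val_rev, iPair_val, iPair_val, Fin.val_rev]; split_ifs <;> omega
  · have := x.2
    unfold val
    rw [iPair_val]; split_ifs <;> push_cast <;> omega
  · have := x.2
    unfold val
    rw [iPair_val]; split_ifs <;> push_cast <;> omega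

theorem good_mid {n : ℕ} (hn : Even n) : Good (iMid (n := n)) := by
  obtain ⟨r, hr⟩ := hn
  refine ⟨fun x y hxy => ?_, fun x => ?_, fun x => ?_, fun x => ?_⟩
  · rw [Fin.lt_def] at *
    rw [iMid_val, iMid_val]; split_ifs <;> omega
  · apply Fin.ext
    have := x.2
    rw [Fin.val_rev, iMid_val, iMid_val, Fin.val_rev]; split_ifs <;> omega
  · have := x.2
    unfold val
    rw [iMid_val]; split_ifs <;> push_cast <;> omega
  · have := x.2
    unfold val
    rw [iMid_val]; split_ifs <;> push_cast <;> omega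

theorem thetaPad_eq {n : ℕ} (θ : Fin n → ℕ) (x : Fin n) (z : ℤ) (h : z = (x : ℕ)) :
    thetaPad θ z = θ x := by
  subst h
  unfold thetaPad
  rw [dif_pos ⟨by omega, by omega⟩]
  congr 1

theorem pair_h1 {n : ℕ} (θ : Fin n → ℕ) (p : Fin (n + 2)) (hp : 0 < val (n + 2) p) (x : Fin n) :
    addZerosPair θ p (iPair p x) = θ x := by
  unfold addZerosPair
  have hv := iPair_val p x
  have := x.2
  unfold val at *
  push_cast at *
  split_ifs with h1 h2 h3
  · exfalso; split_ifs at hv <;> omega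
  · apply thetaPad_eq; split_ifs at hv <;> omega
  · apply thetaPad_eq; split_ifs at hv <;> omega
  · apply thetaPad_eq; split_ifs at hv <;> omega

theorem pair_h2 {n : ℕ} (θ : Fin n → ℕ) (p : Fin (n + 2)) (hp : 0 < val (n + 2) p)
    (y : Fin (n + 2)) (hy : ∀ x, iPair p x ≠ y) : addZerosPair θ p y = 0 := by
  unfold addZerosPair
  have key : ∀ z : ℕ, ∀ hz : z < n, (if z + (p : ℕ) < n + 1 then z
    else if z + 1 < (p : ℕ) then z + 1 else z + 2) ≠ (y : ℕ) := by
    intro z hz h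
    exact hy ⟨z, hz⟩ (Fin.ext (by rw [iPair_val]; exact h))
  have hy2 := y.2
  have hp2 := p.2
  unfold val at *
  push_cast at *
  rw [if_pos]
  by_contra hcon
  rcases lt_trichotomy ((y : ℕ) + (p : ℕ)) (n + 1) with h | h | h
  · refine key y (by omega) ?_
    split_ifs <;> omega
  · omega
  · rcases lt_trichotomy (y : ℕ) (p : ℕ) with h' | h' | h'
    · refine key (y - 1) (by omega) ?_
      split_ifs <;> omega
    · omega
    · refine key (y - 2) (by omega) ?_
      split_ifs <;> omega

theorem mid_h1 {n : ℕ} (hn : Even n) (θ : Fin n → ℕ) (x : Fin n) :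
    addZeroMid θ (iMid x) = θ x := by
  obtain ⟨r, hr⟩ := hn
  unfold addZeroMid
  have hv := iMid_val x
  have := x.2
  unfold val at *
  push_cast at *
  split_ifs with h1 h2
  · exfalso; split_ifs at hv <;> omega
  · apply thetaPad_eq; split_ifs at hv <;> omega
  · apply thetaPad_eq; split_ifs at hv <;> omega

theorem mid_h2 {n : ℕ} (hn : Even n) (θ : Fin n → ℕ)
    (y : Fin (n + 1)) (hy : ∀ x, iMid x ≠ y) : addZeroMid θ y = 0 := by
  obtain ⟨r, hr⟩ := hn
  unfold addZeroMid
  have key : ∀ z : ℕ, ∀ hz : z < n, (if 2 * z < n then z else z + 1) ≠ (y : ℕ) := by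
    intro z hz h
    exact hy ⟨z, hz⟩ (Fin.ext (by rw [iMid_val]; exact h))
  have hy2 := y.2
  unfold val at *
  push_cast at *
  rw [if_pos]
  by_contra hcon
  rcases lt_trichotomy (2 * (y : ℕ)) n with h | h | h
  · refine key y (by omega) ?_
    split_ifs <;> omega
  · omega
  · refine key (y - 1) (by omega) ?_
    split_ifs <;> omega


/-- Let `θ` be a composition of `d` indexed by `𝕀_n`, let `θ'`
(indexed by `𝕀_{n+2}`) be obtained from `θ` by adding `0`'s in pairs at a place
`j > 0` (the value of the place `p`), and, when `n` is even, let `θ''` (indexed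
by `𝕀_{n+1}`) be obtained from `θ` by adding a `0` at place `0`.  Then the
permutation modules `V_θ ⊆ V_n^{⊗d}`, `V_{θ'} ⊆ V_{n+2}^{⊗d}` and
`V_{θ''} ⊆ V_{n+1}^{⊗d}` are pairwise isomorphic as `ℋ^B_{Q,q}(d)`-modules. -/
theorem permutation_modules_iso
    (Q q : k) (hQ : Q ≠ 0) (hq : q ≠ 0) (n d : ℕ) (hn : 0 < n) (hd : 1 ≤ d)
    (θ : Fin n → ℕ) (hθ : ∑ l, θ l = d)
    (p : Fin (n + 2)) (hp : 0 < val (n + 2) p) :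
    heckeIso Q q d n (n + 2) (permMod k (compToTuple (d := d) hn θ))
        (permMod k (compToTuple (d := d) (Nat.succ_pos _) (addZerosPair θ p))) ∧
    (Even n →
      heckeIso Q q d n (n + 1) (permMod k (compToTuple (d := d) hn θ))
          (permMod k (compToTuple (d := d) (Nat.succ_pos _) (addZeroMid θ))) ∧
      heckeIso Q q d (n + 2) (n + 1)
          (permMod k (compToTuple (d := d) (Nat.succ_pos _) (addZerosPair θ p)))
          (permMod k (compToTuple (d := d) (Nat.succ_pos _) (addZeroMid θ)))) := by
  have A := hecke_of_good Q q (good_pair p hp) _ _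
    (compToTuple_map hn (Nat.succ_pos _) (good_pair p hp).mono θ hθ _ (pair_h1 θ p hp)
      (pair_h2 θ p hp))
  refine ⟨A, fun he => ?_⟩
  have B := hecke_of_good Q q (good_mid he) _ _
    (compToTuple_map hn (Nat.succ_pos _) (good_mid he).mono θ hθ _ (mid_h1 he θ)
      (mid_h2 he θ))
  exact ⟨B, hecke_trans (hecke_symm A) B⟩


end QSP
end
end
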